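/- Let M ⊆ ℤ^m be a positive affine seminormal monoid and p a prime number such that for every face F of cone(M), multiplication by p is injective on the quotient group (gp(M) ∩ ℝF)/gp(M ∩ F). Then pM = M ∩ p·gp(M). -/

import Mathlib

noncomputable section

/-- The canonical embedding `ℤ^m → ℝ^m`. -/
def toR {m : ℕ} (x : Fin m → ℤ) : Fin m → ℝ := fun i => (x i : ℝ)

/-- The subgroup of `ℤ^m` generated by a submonoid `M`. -/
def gp {m : ℕ} (M : AddSubmonoid (Fin m → ℤ)) : AddSubgroup (Fin m → ℤ) :=
  AddSubgroup.closure (M : Set (Fin m → ℤ))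

/-- The convex cone in `ℝ^m` generated by `M`: all nonnegative real combinations
of elements of `M`. -/
def coneM {m : ℕ} (M : AddSubmonoid (Fin m → ℤ)) : Set (Fin m → ℝ) :=
  {x | ∃ (n : ℕ) (c : Fin n → ℝ) (v : Fin n → (Fin m → ℤ)),
    (∀ i, 0 ≤ c i) ∧ (∀ i, v i ∈ M) ∧ x = ∑ i, c i • toR (v i)}

/-- Faces of `coneM M`: the cone itself, or an intersection with a supporting
hyperplane given by a linear form nonnegative on the cone. -/
def IsFace {m : ℕ} (M : AddSubmonoid (Fin m → ℤ)) (F : Set (Fin m → ℝ)) : Prop :=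
  F = coneM M ∨ ∃ α : (Fin m → ℝ) →ₗ[ℝ] ℝ,
    (∀ x ∈ coneM M, 0 ≤ α x) ∧ F = {x ∈ coneM M | α x = 0}

/-- A facet: a maximal proper face. -/
def IsFacet {m : ℕ} (M : AddSubmonoid (Fin m → ℤ)) (F : Set (Fin m → ℝ)) : Prop :=
  IsFace M F ∧ F ≠ coneM M ∧ ∀ G, IsFace M G → F ⊆ G → G = F ∨ G = coneM M

/-- The subgroup `gp(M ∩ F)` of `ℤ^m` generated by the elements of `M` lying
in the face `F`. -/
def gpF {m : ℕ} (M : AddSubmonoid (Fin m → ℤ)) (F : Set (Fin m → ℝ)) :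
    AddSubgroup (Fin m → ℤ) :=
  AddSubgroup.closure {a : Fin m → ℤ | a ∈ M ∧ toR a ∈ F}

/-- `M` is seminormal: `z ∈ gp(M)`, `2z ∈ M`, `3z ∈ M` imply `z ∈ M`. -/
def Seminormal {m : ℕ} (M : AddSubmonoid (Fin m → ℤ)) : Prop :=
  ∀ z ∈ gp M, 2 • z ∈ M → 3 • z ∈ M → z ∈ M

/-- `M` is normal: `z ∈ gp(M)`, `kz ∈ M` for some `k ≥ 1` imply `z ∈ M`. -/
def IsNormal {m : ℕ} (M : AddSubmonoid (Fin m → ℤ)) : Prop :=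
  ∀ z ∈ gp M, (∃ k : ℕ, 0 < k ∧ k • z ∈ M) → z ∈ M

/-- `M` is positive: `0` is the only invertible element. -/
def Positive {m : ℕ} (M : AddSubmonoid (Fin m → ℤ)) : Prop :=
  ∀ a ∈ M, -a ∈ M → a = 0

/-- The localization monoid `M_F` of `M` at a face `F`:
elements `a ∈ gp(M)` with `a + b ∈ M` for some `b ∈ M ∩ F`. -/
def locM {m : ℕ} (M : AddSubmonoid (Fin m → ℤ)) (F : Set (Fin m → ℝ)) :
    Set (Fin m → ℤ) :=
  {a | a ∈ gp M ∧ ∃ b, b ∈ M ∧ toR b ∈ F ∧ a + b ∈ M}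

/-- An integral form of Farkas' lemma: if every additive functional that is nonnegative on a finite
list of integer vectors is nonnegative at `b`, then some positive multiple of `b` is a sum of
vectors in the list. -/
theorem exists_nsmul_mem_closure_of_forall_nonneg {m : ℕ} (l : List (Fin m → ℤ)) (b : Fin m → ℤ)
    (h : ∀ f : (Fin m → ℤ) →+ ℤ, (∀ a ∈ l, 0 ≤ f a) → 0 ≤ f b) :
    ∃ N : ℕ, 0 < N ∧ N • b ∈ AddSubmonoid.closure {a | a ∈ l} := by
  induction hn : l.length generalizing l b with
  | zero =>
    obtain rfl := List.length_eq_zero_iff.mp hn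
    have hb : b = 0 := by
      ext i
      have h₁ := h (Pi.evalAddMonoidHom _ i) (by simp)
      have h₂ := h (-Pi.evalAddMonoidHom _ i) (by simp)
      simp only [AddMonoidHom.neg_apply, Pi.evalAddMonoidHom_apply] at h₁ h₂
      simp only [Pi.zero_apply]
      omega
    exact ⟨1, one_pos, by simp [hb]⟩
  | succ n ih =>
    obtain _ | ⟨a₀, l⟩ := l
    · simp at hn
    have hl : l.length = n := by simpa using hn
    have hsub : AddSubmonoid.closure {a | a ∈ l} ≤ AddSubmonoid.closure {a | a ∈ a₀ :: l} :=
      AddSubmonoid.closure_mono fun a ha => List.mem_cons_of_mem _ ha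
    by_cases hlb : ∀ f : (Fin m → ℤ) →+ ℤ, (∀ a ∈ l, 0 ≤ f a) → 0 ≤ f b
    · obtain ⟨N, hN, hmem⟩ := ih l b hlb hl
      exact ⟨N, hN, hsub hmem⟩
    push Not at hlb
    obtain ⟨g, hgl, hgb⟩ := hlb
    have hga : g a₀ < 0 := by
      by_contra! hga
      exact absurd (h g (by simpa using ⟨hga, hgl⟩)) (not_le.mpr hgb)
    obtain ⟨c, hc⟩ := Int.eq_ofNat_of_zero_le (neg_nonneg.mpr hga.le)
    let φ : (Fin m → ℤ) →+ (Fin m → ℤ) :=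
      { toFun := fun x => c • x + g x • a₀
        map_zero' := by simp
        map_add' := fun x y => by simp only [map_add, smul_add, add_smul]; abel }
    have hφ : ∀ x, φ x = c • x + g x • a₀ := fun _ => rfl
    obtain ⟨N, hN, hmem⟩ := ih (l.map φ) (φ b) (fun f hf => by
      have key := h (c • f + f a₀ • g) (by
        intro a ha
        rcases List.mem_cons.mp ha with rfl | ha
        · simp only [AddMonoidHom.add_apply, AddMonoidHom.smul_apply, nsmul_eq_mul, smul_eq_mul]
          rw [← hc]
          exact le_of_eq (by ring)
        · have := hf _ (List.mem_map_of_mem (f := φ) ha)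
          simp only [hφ, map_add, map_nsmul, map_zsmul] at this
          simp only [nsmul_eq_mul, smul_eq_mul] at this
          simp only [AddMonoidHom.add_apply, AddMonoidHom.smul_apply, nsmul_eq_mul, smul_eq_mul]
          linarith)
      simp only [AddMonoidHom.add_apply, AddMonoidHom.smul_apply, nsmul_eq_mul,
        smul_eq_mul] at key
      simp only [hφ, map_add, map_nsmul, map_zsmul]
      simp only [nsmul_eq_mul, smul_eq_mul]
      linarith) (by simpa using hl)
    have himg : {a | a ∈ l.map φ} = φ '' {a | a ∈ l} := by ext; simp
    rw [himg, ← AddMonoidHom.map_mclosure] at hmem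
    obtain ⟨y, hy, hyb⟩ := hmem
    have hgy : 0 ≤ g y := by
      clear hyb
      induction hy using AddSubmonoid.closure_induction with
      | mem a ha => exact hgl a ha
      | zero => simp
      | add a b _ _ ha hb => rw [map_add]; exact add_nonneg ha hb
    have hNg : 0 ≤ g y - N * g b := by nlinarith
    obtain ⟨k, hk⟩ := Int.eq_ofNat_of_zero_le hNg
    refine ⟨N * c, Nat.mul_pos hN (by omega), ?_⟩
    have heq : (N * c) • b = c • y + k • a₀ := by
      rw [hφ, hφ] at hyb
      ext i
      have hi := congrFun hyb i
      simp only [Pi.add_apply, Pi.smul_apply] at hi ⊢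
      simp only [nsmul_eq_mul, smul_eq_mul] at hi ⊢
      push_cast
      rw [← hk]
      linarith
    rw [heq]
    have ha₀ : a₀ ∈ AddSubmonoid.closure {a | a ∈ a₀ :: l} :=
      AddSubmonoid.subset_closure (by simp)
    exact add_mem (nsmul_mem (hsub hy) _) (nsmul_mem ha₀ _)

/-- For an element `x` of a finitely generated submonoid `M` of `ℤ^m` there is an additive
functional, nonnegative on `M` and vanishing at `x`, whose zeros in `M` are summands of multiples
of `x`: it cuts out the smallest face containing `x`. -/
theorem exists_supporting_functional {m : ℕ} {M : AddSubmonoid (Fin m → ℤ)} (hFG : M.FG)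
    {x : Fin m → ℤ} (hx : x ∈ M) :
    ∃ f : (Fin m → ℤ) →+ ℤ, (∀ a ∈ M, 0 ≤ f a) ∧ f x = 0 ∧
      ∀ b ∈ M, f b = 0 → ∃ k : ℕ, k • x - b ∈ M := by
  obtain ⟨S, rfl⟩ := hFG
  set M := AddSubmonoid.closure (S : Set (Fin m → ℤ)) with hM
  have hmemS : ∀ s ∈ S, s ∈ M := fun s hs => AddSubmonoid.subset_closure hs
  have hsep : ∀ s ∈ S, ∃ f : (Fin m → ℤ) →+ ℤ, (∀ a ∈ M, 0 ≤ f a) ∧ f x = 0 ∧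
      (f s = 0 → ∃ k : ℕ, k • x - s ∈ M) := by
    intro s hs
    by_cases hf : ∀ f : (Fin m → ℤ) →+ ℤ, (∀ a ∈ -x :: S.toList, 0 ≤ f a) → 0 ≤ f (-s)
    · refine ⟨0, by simp, by simp, fun _ => ?_⟩
      obtain ⟨N, hN, hmem⟩ := exists_nsmul_mem_closure_of_forall_nonneg _ _ hf
      have hset : {a | a ∈ -x :: S.toList} = {-x} ∪ (S : Set (Fin m → ℤ)) := by
        ext; simp
      rw [hset, AddSubmonoid.closure_union, AddSubmonoid.mem_sup] at hmem
      obtain ⟨u, hu, v, hv, huv⟩ := hmem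
      obtain ⟨k, rfl⟩ := AddSubmonoid.mem_closure_singleton.mp hu
      obtain ⟨N, rfl⟩ := Nat.exists_eq_add_of_lt hN
      refine ⟨k, ?_⟩
      have heq : k • x - s = v + N • s := by
        rw [zero_add, add_smul, one_smul, smul_neg, smul_neg] at huv
        rw [← sub_eq_zero] at huv ⊢
        rw [← neg_eq_zero, ← huv]
        abel
      rw [heq]
      exact add_mem hv (nsmul_mem (hmemS s hs) N)
    · push Not at hf
      obtain ⟨f, hf, hfs⟩ := hf
      have hfM : ∀ a ∈ M, 0 ≤ f a := by
        intro a ha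
        induction ha using AddSubmonoid.closure_induction with
        | mem a ha => exact hf a (List.mem_cons_of_mem _ (by simpa using ha))
        | zero => simp
        | add a b _ _ ha hb => rw [map_add]; exact add_nonneg ha hb
      have hfx := hf (-x) List.mem_cons_self
      rw [map_neg] at hfx hfs
      exact ⟨f, hfM, le_antisymm (by omega) (hfM x hx), fun h => by omega⟩
  choose! f hfM hfx hfs using hsep
  have hnonneg : ∀ a ∈ M, 0 ≤ (∑ s ∈ S, f s) a := fun a ha => by
    rw [AddMonoidHom.finsetSum_apply]
    exact Finset.sum_nonneg fun s hs => hfM s hs a ha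
  refine ⟨∑ s ∈ S, f s, hnonneg, ?_, ?_⟩
  · rw [AddMonoidHom.finsetSum_apply]
    exact Finset.sum_eq_zero hfx
  · intro b hb
    induction hb using AddSubmonoid.closure_induction with
    | mem s hs =>
      intro h
      rw [AddMonoidHom.finsetSum_apply, Finset.sum_eq_zero_iff_of_nonneg
        fun t ht => hfM t ht s (hmemS s hs)] at h
      exact hfs s hs (h s hs)
    | zero => exact fun _ => ⟨0, by simp⟩
    | add a b ha hb iha ihb =>
      intro h
      rw [map_add] at h
      have ha' := hnonneg a ha
      have hb' := hnonneg b hb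
      obtain ⟨k, hk⟩ := iha (by omega)
      obtain ⟨n, hn⟩ := ihb (by omega)
      refine ⟨k + n, ?_⟩
      have heq : (k + n) • x - (a + b) = (k • x - a) + (n • x - b) := by
        rw [add_smul]; abel
      rw [heq]
      exact add_mem hk hn

/-- Every integral functional on `ℤ^m` extends to a real linear form on `ℝ^m`. -/
theorem exists_linearMap_toR {m : ℕ} (f : (Fin m → ℤ) →+ ℤ) :
    ∃ α : (Fin m → ℝ) →ₗ[ℝ] ℝ, ∀ a, α (toR a) = f a := by
  refine ⟨∑ i, (f (Pi.single i 1) : ℝ) • LinearMap.proj i, fun a => ?_⟩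
  have ha : f a = ∑ i, f (Pi.single i 1) * a i := by
    conv_lhs => rw [← Finset.univ_sum_single a]
    rw [map_sum]
    refine Finset.sum_congr rfl fun i _ => ?_
    have : (Pi.single i (a i) : Fin m → ℤ) = a i • Pi.single i 1 := by
      rw [← Pi.single_smul, smul_eq_mul, mul_one]
    rw [this, map_zsmul, smul_eq_mul, mul_comm]
  rw [ha]
  simp [toR, LinearMap.sum_apply]

theorem toR_mem_coneM {m : ℕ} {M : AddSubmonoid (Fin m → ℤ)} {a : Fin m → ℤ} (ha : a ∈ M) :
    toR a ∈ coneM M :=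
  ⟨1, fun _ => 1, fun _ => a, fun _ => zero_le_one, fun _ => ha, by simp⟩

/-- In a seminormal monoid, an element of the group all of whose large multiples lie in the monoid
lies in the monoid. -/
theorem Seminormal.mem_of_forall_ge {m : ℕ} {M : AddSubmonoid (Fin m → ℤ)} (hsn : Seminormal M)
    {z : Fin m → ℤ} (hz : z ∈ gp M) (K : ℕ) (hK : ∀ k ≥ K, k • z ∈ M) : z ∈ M := by
  induction K with
  | zero => simpa using hK 1 (Nat.zero_le 1)
  | succ K ih =>
    refine ih fun k hk => ?_
    rcases hk.lt_or_eq with hlt | rfl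
    · exact hK k hlt
    rcases Nat.eq_zero_or_pos K with rfl | hpos
    · simp
    refine hsn _ (nsmul_mem hz K) ?_ ?_
    · rw [smul_smul]; exact hK _ (by omega)
    · rw [smul_smul]; exact hK _ (by omega)

/-- For a positive affine seminormal monoid `M` and a prime `p` such
that multiplication by `p` is injective on `(gp(M) ∩ ℝF)/gp(M ∩ F)` for every face
`F`, one has `pM = M ∩ p·gp(M)`. -/
theorem pM_eq_inter {m : ℕ} (M : AddSubmonoid (Fin m → ℤ)) (hFG : M.FG)
    (hpos : Positive M) (hsn : Seminormal M) (p : ℕ) (hp : p.Prime)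
    (hinj : ∀ F : Set (Fin m → ℝ), IsFace M F → ∀ z ∈ gp M,
      toR z ∈ Submodule.span ℝ F → p • z ∈ gpF M F → z ∈ gpF M F) :
    {x : Fin m → ℤ | ∃ a ∈ M, x = p • a} =
      {x : Fin m → ℤ | x ∈ M ∧ ∃ z ∈ gp M, x = p • z} := by
  ext x
  simp only [Set.mem_ofPred_eq]
  constructor
  · rintro ⟨a, ha, rfl⟩
    exact ⟨nsmul_mem ha p, a, AddSubgroup.subset_closure ha, rfl⟩
  rintro ⟨hx, z, hz, hxz⟩
  obtain ⟨f, hfM, hfx, hfG⟩ := exists_supporting_functional hFG hx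
  obtain ⟨α, hα⟩ := exists_linearMap_toR f
  have hface : IsFace M {y ∈ coneM M | α y = 0} := by
    refine Or.inr ⟨α, ?_, rfl⟩
    rintro y ⟨n, c, v, hc, hv, rfl⟩
    rw [map_sum]
    refine Finset.sum_nonneg fun i _ => ?_
    rw [map_smul, hα, smul_eq_mul]
    exact mul_nonneg (hc i) (by exact_mod_cast hfM _ (hv i))
  have hxF : toR x ∈ {y ∈ coneM M | α y = 0} := ⟨toR_mem_coneM hx, by rw [hα, hfx, Int.cast_zero]⟩
  have hspan : toR z ∈ Submodule.span ℝ {y ∈ coneM M | α y = 0} := by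
    have hp0 : (p : ℝ) ≠ 0 := Nat.cast_ne_zero.mpr hp.ne_zero
    have heq : toR z = (p : ℝ)⁻¹ • toR x := by
      ext i
      simp [hxz, toR, hp0]
    rw [heq]
    exact Submodule.smul_mem _ _ (Submodule.subset_span hxF)
  have hzF := hinj _ hface z hz hspan (hxz ▸ AddSubgroup.subset_closure ⟨hx, hxF⟩)
  have hdiff : ∃ u ∈ M, ∃ v ∈ M, f u = 0 ∧ f v = 0 ∧ z = u - v := by
    clear hxz hspan hz
    induction hzF using AddSubgroup.closure_induction with
    | mem a ha =>
      have hfa := ha.2.2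
      rw [hα] at hfa
      exact ⟨a, ha.1, 0, zero_mem _, by exact_mod_cast hfa, map_zero f, (sub_zero a).symm⟩
    | zero => exact ⟨0, zero_mem _, 0, zero_mem _, map_zero f, map_zero f, (sub_zero 0).symm⟩
    | add a b _ _ iha ihb =>
      obtain ⟨u, hu, v, hv, hfu, hfv, rfl⟩ := iha
      obtain ⟨u', hu', v', hv', hfu', hfv', rfl⟩ := ihb
      exact ⟨u + u', add_mem hu hu', v + v', add_mem hv hv', by simp [hfu, hfu'],
        by simp [hfv, hfv'], by abel⟩
    | neg a _ iha =>
      obtain ⟨u, hu, v, hv, hfu, hfv, rfl⟩ := iha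
      exact ⟨v, hv, u, hu, hfv, hfu, by abel⟩
  obtain ⟨u, hu, v, hv, -, hfv, hzuv⟩ := hdiff
  obtain ⟨N, hN⟩ := hfG v hv hfv
  refine ⟨z, hsn.mem_of_forall_ge hz (p * (p * N)) fun k hk => ?_, hxz⟩
  have hr : k % p ≤ p := (Nat.mod_lt k hp.pos).le
  have hq : k % p * N ≤ k / p :=
    (Nat.mul_le_mul_right N hr).trans ((Nat.le_div_iff_mul_le hp.pos).mpr (by linarith))
  obtain ⟨d, hd⟩ := Nat.exists_eq_add_of_le hq
  have hkz : k • z = d • x + (k % p) • (N • x - v) + (k % p) • u := by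
    calc k • z = (k / p) • (p • z) + (k % p) • z := by
          rw [smul_smul, ← add_smul, mul_comm, Nat.div_add_mod]
      _ = (k % p * N + d) • x + (k % p) • (u - v) := by rw [← hxz, hd, ← hzuv]
      _ = _ := by
          rw [add_smul, mul_smul, smul_sub, smul_sub]
          abel
  rw [hkz]
  exact add_mem (add_mem (nsmul_mem hx d) (nsmul_mem hN _)) (nsmul_mem hu _)
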